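/- Let A be the smallest closed star-subalgebra of the bounded operators on H = ℓ²(Γ) containing Z₁,…,Z_{ℓ+1} (a concrete realization of C(S_q^{2ℓ+1})), and let J be the smallest closed two-sided ideal of A containing Z_{ℓ+1}. For α, β ∈ (Fin ℓ → ℕ) and m ∈ ℤ let T_{α,β,m} be the bounded operator on H determined by T_{α,β,m} e_{(μ,n)} = e_{(α, n+m)} if μ = β and T_{α,β,m} e_{(μ,n)} = 0 otherwise. Then J equals the closed linear span of {T_{α,β,m} : α, β ∈ (Fin ℓ → ℕ), m ∈ ℤ}. (This closed span is a concrete realization of K(ℓ²(ℕ^ℓ)) ⊗ C(S¹), so J ≅ K ⊗ C(S¹).) -/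

import Mathlib

open scoped BigOperators InnerProductSpace

noncomputable section

/-- The index set `Γ = ℕ^ℓ × ℤ`. -/
abbrev Gamma (ℓ : ℕ) : Type := (Fin ℓ → ℕ) × ℤ

/-- The Hilbert space `H = ℓ²(Γ)`. -/
abbrev Hsp (ℓ : ℕ) := lp (fun _ : Gamma ℓ => ℂ) 2

/-- The standard orthonormal basis vector `e_γ`. -/
def e (ℓ : ℕ) (γ : Gamma ℓ) : Hsp ℓ := lp.single 2 γ 1

/-- `ε_k ∈ Γ`: the element whose `k`-th coordinate is `1` and all other coordinates are `0`
(`k` is zero-indexed: `k : Fin (ℓ+1)` corresponds to the coordinate `k+1` of the paper). -/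
def eps (ℓ : ℕ) (k : Fin (ℓ+1)) : Gamma ℓ :=
  if h : (k : ℕ) < ℓ then (Pi.single ⟨(k : ℕ), h⟩ 1, 0) else (0, 1)

/-- The `k`-th coordinate of `γ ∈ Γ`, viewed in `ℤ` (zero-indexed). -/
def coord {ℓ : ℕ} (γ : Gamma ℓ) (k : Fin (ℓ+1)) : ℤ :=
  if h : (k : ℕ) < ℓ then (γ.1 ⟨(k : ℕ), h⟩ : ℤ) else γ.2

/-- `γ(1) + … + γ(k−1)` (sum of the coordinates strictly before position `k`). -/
def sumBelow {ℓ : ℕ} (k : Fin (ℓ+1)) (γ : Gamma ℓ) : ℕ :=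
  ∑ j ∈ Finset.univ.filter (fun j : Fin ℓ => (j : ℕ) < (k : ℕ)), γ.1 j

/-- The growth condition `|d(γ+ε_k) − d(γ)| ≤ c·q^{−(γ(1)+…+γ(k−1))}` for all `γ` and `k`. -/
def GrowthCondition (ℓ : ℕ) (q c : ℝ) (d : Gamma ℓ → ℝ) : Prop :=
  ∀ (k : Fin (ℓ+1)) (γ : Gamma ℓ),
    |d (γ + eps ℓ k) - d γ| ≤ c * (q ^ sumBelow k γ)⁻¹

/-- The coefficient `c_k(γ)`: for `1 ≤ k ≤ ℓ` (i.e. `(k:ℕ) < ℓ` in zero-indexing),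
`c_k(γ) = q^{γ(1)+…+γ(k−1)}·√(1 − q^{2(γ(k)+1)})`, and `c_{ℓ+1}(γ) = q^{γ(1)+…+γ(ℓ)}`. -/
def ck (ℓ : ℕ) (q : ℝ) (k : Fin (ℓ+1)) (γ : Gamma ℓ) : ℝ :=
  q ^ sumBelow k γ *
    (if h : (k : ℕ) < ℓ then Real.sqrt (1 - q ^ (2 * (γ.1 ⟨(k : ℕ), h⟩ + 1))) else 1)

section Helpers

open Filter Topology

variable {ℓ : ℕ} {q : ℝ}

/-- The defining relations of `Z₁, …, Z_{ℓ+1}` on basis vectors. -/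
def IsSphereFamily (q : ℝ) (Z : Fin (ℓ + 1) → Hsp ℓ →L[ℂ] Hsp ℓ) : Prop :=
  ∀ (k : Fin (ℓ + 1)) (γ : Gamma ℓ),
    Z k (e ℓ γ) = ((ck ℓ q k γ : ℝ) : ℂ) • e ℓ (γ + eps ℓ k)

/-- The defining relations of the operators `T_{α,β,m}` on basis vectors. -/
def IsShiftUnits (T : (Fin ℓ → ℕ) → (Fin ℓ → ℕ) → ℤ → Hsp ℓ →L[ℂ] Hsp ℓ) : Prop :=
  ∀ (α β : Fin ℓ → ℕ) (m : ℤ) (μ : Fin ℓ → ℕ) (n : ℤ),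
    T α β m (e ℓ (μ, n)) = if μ = β then e ℓ (α, n + m) else 0

/-- The closed linear span of the operators `T_{α,β,m}`. -/
def shiftSpan (T : (Fin ℓ → ℕ) → (Fin ℓ → ℕ) → ℤ → Hsp ℓ →L[ℂ] Hsp ℓ) :
    Submodule ℂ (Hsp ℓ →L[ℂ] Hsp ℓ) :=
  (Submodule.span ℂ (Set.range fun p : (Fin ℓ → ℕ) × (Fin ℓ → ℕ) × ℤ =>
    T p.1 p.2.1 p.2.2)).topologicalClosure

theorem e_apply (γ δ : Gamma ℓ) : e ℓ γ δ = if δ = γ then 1 else 0 := by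
  simp [e, Pi.single_apply]

theorem inner_e_left (γ : Gamma ℓ) (f : Hsp ℓ) : ⟪e ℓ γ, f⟫_ℂ = f γ := by
  simp [e, lp.inner_single_left]

theorem clm_ext_e {F : Type*} [NormedAddCommGroup F] [NormedSpace ℂ F]
    {X Y : Hsp ℓ →L[ℂ] F} (h : ∀ γ, X (e ℓ γ) = Y (e ℓ γ)) : X = Y := by
  ext f
  have hf : HasSum (fun γ => f γ • e ℓ γ) f := by
    have := lp.hasSum_single (p := 2) (by simp) f
    convert this using 2 with γ
    ext δ
    simp [e, Pi.single_apply]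
  have hX := hf.mapL X
  have hY := hf.mapL Y
  simp only [map_smul, h] at hX hY
  exact hX.unique hY

theorem vec_ext_inner {f g : Hsp ℓ} (h : ∀ γ, ⟪e ℓ γ, f⟫_ℂ = ⟪e ℓ γ, g⟫_ℂ) : f = g := by
  ext γ
  simpa [inner_e_left] using h γ

theorem norm_le_of_weighted_shift {X : Hsp ℓ →L[ℂ] Hsp ℓ} {σ : Gamma ℓ → Gamma ℓ}
    (hσ : Function.Injective σ) {x : Gamma ℓ → ℂ}
    (hX : ∀ γ, X (e ℓ γ) = x γ • e ℓ (σ γ)) {C : ℝ} (hC : 0 ≤ C) (hx : ∀ γ, ‖x γ‖ ≤ C) :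
    ‖X‖ ≤ C := by
  have h_on (γ : Gamma ℓ) : (innerSL ℂ (e ℓ (σ γ))).comp X = x γ • innerSL ℂ (e ℓ γ) := by
    refine clm_ext_e fun δ => ?_
    simp only [ContinuousLinearMap.comp_apply, smul_apply, innerSL_apply_apply, hX,
      inner_smul_right, inner_e_left, e_apply, hσ.eq_iff, smul_eq_mul]
    split_ifs with h <;> simp [h]
  have h_off (δ : Gamma ℓ) (hδ : δ ∉ Set.range σ) : (innerSL ℂ (e ℓ δ)).comp X = 0 := by
    refine clm_ext_e fun γ => ?_
    have : δ ≠ σ γ := fun h => hδ ⟨γ, h.symm⟩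
    simp [hX, inner_e_left, e_apply, this]
  refine X.opNorm_le_bound hC fun f => ?_
  have c_on (γ : Gamma ℓ) : X f (σ γ) = x γ * f γ := by
    simpa [inner_e_left] using congrArg (fun L => L f) (h_on γ)
  have c_off (δ : Gamma ℓ) (hδ : δ ∉ Set.range σ) : X f δ = 0 := by
    simpa [inner_e_left] using congrArg (fun L => L f) (h_off δ hδ)
  refine lp.norm_le_of_forall_sum_le (p := 2) (by simp) (by positivity) fun s => ?_
  classical
  have hpre := Finset.sum_preimage σ s hσ.injOn
    (fun δ => ‖X f δ‖ ^ (2 : ENNReal).toReal) (fun δ _ hδ => by simp [c_off δ hδ])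
  rw [← hpre]
  calc ∑ γ ∈ s.preimage σ hσ.injOn, ‖X f (σ γ)‖ ^ (2 : ENNReal).toReal
      ≤ ∑ γ ∈ s.preimage σ hσ.injOn, C ^ (2 : ENNReal).toReal * ‖f γ‖ ^ (2 : ENNReal).toReal := by
        refine Finset.sum_le_sum fun γ _ => ?_
        rw [c_on, norm_mul, ← Real.mul_rpow hC (norm_nonneg _)]
        gcongr
        exact hx γ
    _ ≤ (C * ‖f‖) ^ (2 : ENNReal).toReal := by
        rw [← Finset.mul_sum, Real.mul_rpow hC (norm_nonneg _)]
        gcongr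
        exact lp.sum_rpow_le_norm_rpow (by simp) f _

theorem eps_last : eps ℓ (Fin.last ℓ) = (0, 1) := by
  simp [eps]

theorem eps_castSucc (k : Fin ℓ) : eps ℓ k.castSucc = (Pi.single k 1, 0) := by
  simp [eps]

theorem ck_last (γ : Gamma ℓ) : ck ℓ q (Fin.last ℓ) γ = q ^ ∑ j, γ.1 j := by
  simp [ck, sumBelow]

theorem ck_congr (k : Fin (ℓ + 1)) (μ : Fin ℓ → ℕ) (m n : ℤ) :
    ck ℓ q k (μ, m) = ck ℓ q k (μ, n) := rfl

theorem ck_ne_zero (hq : 0 < q) (hq1 : q < 1) (k : Fin (ℓ + 1)) (γ : Gamma ℓ) :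
    ck ℓ q k γ ≠ 0 := by
  unfold ck
  refine mul_ne_zero (pow_pos hq _).ne' ?_
  split_ifs with h
  · exact (Real.sqrt_pos.2 (sub_pos.2 (pow_lt_one₀ hq.le hq1 (by omega)))).ne'
  · exact one_ne_zero

variable {Z : Fin (ℓ + 1) → Hsp ℓ →L[ℂ] Hsp ℓ}
  {T : (Fin ℓ → ℕ) → (Fin ℓ → ℕ) → ℤ → Hsp ℓ →L[ℂ] Hsp ℓ}

theorem IsShiftUnits.star_eq (hT : IsShiftUnits T) (α β : Fin ℓ → ℕ) (m : ℤ) :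
    star (T α β m) = T β α (-m) := by
  refine clm_ext_e fun ⟨μ, n⟩ => vec_ext_inner fun ⟨ν, p⟩ => ?_
  rw [ContinuousLinearMap.star_eq_adjoint, ContinuousLinearMap.adjoint_inner_right, hT, hT]
  have h : p + m = n ↔ p = n + -m := by omega
  split_ifs with h₁ h₂ h₂ <;> simp_all [inner_e_left, e_apply, eq_comm]

theorem IsSphereFamily.last_mul (hZ : IsSphereFamily q Z) (hT : IsShiftUnits T)
    (α β : Fin ℓ → ℕ) (m : ℤ) :
    Z (Fin.last ℓ) * T α β m = ((q ^ ∑ j, α j : ℝ) : ℂ) • T α β (m + 1) := by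
  refine clm_ext_e fun ⟨μ, n⟩ => ?_
  simp only [mul_apply_eq_comp, smul_apply, hT _ _ _ μ n]
  split_ifs <;> simp [hZ _ _, ck_last, eps_last, add_assoc]

theorem IsSphereFamily.mul_last (hZ : IsSphereFamily q Z) (hT : IsShiftUnits T)
    (α β : Fin ℓ → ℕ) (m : ℤ) :
    T α β m * Z (Fin.last ℓ) = ((q ^ ∑ j, β j : ℝ) : ℂ) • T α β (m + 1) := by
  refine clm_ext_e fun ⟨μ, n⟩ => ?_
  simp only [mul_apply_eq_comp, smul_apply, hZ _ _, map_smul,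
    eps_last, Prod.mk_add_mk, add_zero, hT _ _ _ μ _, ck_last]
  split_ifs with h
  · rw [h, add_assoc, add_comm 1 m]
  · simp

theorem IsSphereFamily.castSucc_mul (hZ : IsSphereFamily q Z) (hT : IsShiftUnits T) (k : Fin ℓ)
    (α β : Fin ℓ → ℕ) (m : ℤ) :
    Z k.castSucc * T α β m = ((ck ℓ q k.castSucc (α, 0) : ℝ) : ℂ) • T (α + Pi.single k 1) β m := by
  refine clm_ext_e fun ⟨μ, n⟩ => ?_
  simp only [mul_apply_eq_comp, smul_apply, hT _ _ _ μ n]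
  split_ifs
  · simp [hZ _ _, eps_castSucc, ck_congr _ α (n + m) 0]
  · simp

theorem IsSphereFamily.mul_castSucc_add (hZ : IsSphereFamily q Z) (hT : IsShiftUnits T)
    (k : Fin ℓ) (α β : Fin ℓ → ℕ) (m : ℤ) :
    T α (β + Pi.single k 1) m * Z k.castSucc =
      ((ck ℓ q k.castSucc (β, 0) : ℝ) : ℂ) • T α β m := by
  refine clm_ext_e fun ⟨μ, n⟩ => ?_
  simp only [mul_apply_eq_comp, smul_apply, hZ _ _, map_smul,
    eps_castSucc, Prod.mk_add_mk, add_zero, hT _ _ _ _ _, add_left_inj]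
  split_ifs with h
  · rw [h, ck_congr _ β n 0]
  · simp

theorem IsSphereFamily.mul_castSucc_of_eq_zero (hZ : IsSphereFamily q Z) (hT : IsShiftUnits T)
    (k : Fin ℓ) (α β : Fin ℓ → ℕ) (m : ℤ) (hβ : β k = 0) :
    T α β m * Z k.castSucc = 0 := by
  refine clm_ext_e fun ⟨μ, n⟩ => ?_
  have h : μ + Pi.single k 1 ≠ β := fun h => by simp [← h] at hβ
  simp [hZ _ _, eps_castSucc, hT _ _ _ _ _, h]

theorem mem_shiftSpan (α β : Fin ℓ → ℕ) (m : ℤ) : T α β m ∈ shiftSpan T :=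
  Submodule.le_topologicalClosure _ (Submodule.subset_span ⟨(α, β, m), rfl⟩)

theorem isClosed_shiftSpan : IsClosed (shiftSpan T : Set (Hsp ℓ →L[ℂ] Hsp ℓ)) :=
  Submodule.isClosed_topologicalClosure _

/-- A closed subspace which contains all `T_{α,β,m}` contains their closed span. -/
theorem shiftSpan_le {M : Submodule ℂ (Hsp ℓ →L[ℂ] Hsp ℓ)}
    (hM : IsClosed (M : Set (Hsp ℓ →L[ℂ] Hsp ℓ))) (h : ∀ α β m, T α β m ∈ M) :
    shiftSpan T ≤ M :=
  Submodule.topologicalClosure_minimal _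
    (Submodule.span_le.2 (Set.range_subset_iff.2 fun _ => h _ _ _)) hM

theorem IsShiftUnits.star_mem (hT : IsShiftUnits T) {x : Hsp ℓ →L[ℂ] Hsp ℓ}
    (hx : x ∈ shiftSpan T) : star x ∈ shiftSpan T := by
  let M : Submodule ℂ (Hsp ℓ →L[ℂ] Hsp ℓ) :=
    { carrier := {y | star y ∈ shiftSpan T}
      add_mem' := fun {a b} ha hb => by
        simpa only [Set.mem_ofPred_eq, star_add] using add_mem ha hb
      zero_mem' := by simp
      smul_mem' := fun c y hy => by
        simpa only [Set.mem_ofPred_eq, star_smul] using Submodule.smul_mem _ _ hy }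
  refine shiftSpan_le (M := M) (isClosed_shiftSpan.preimage continuous_star) (fun α β m => ?_) hx
  change star (T α β m) ∈ shiftSpan T
  rw [hT.star_eq]
  exact mem_shiftSpan _ _ _

theorem IsSphereFamily.gen_mul_mem (hZ : IsSphereFamily q Z) (hT : IsShiftUnits T)
    (k : Fin (ℓ + 1)) {x : Hsp ℓ →L[ℂ] Hsp ℓ} (hx : x ∈ shiftSpan T) :
    Z k * x ∈ shiftSpan T := by
  refine shiftSpan_le (M := (shiftSpan T).comap (LinearMap.mulLeft ℂ (Z k)))
    (isClosed_shiftSpan.preimage (continuous_const_mul (Z k))) (fun α β m => ?_) hx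
  rw [Submodule.mem_comap, LinearMap.mulLeft_apply]
  induction k using Fin.lastCases with
  | last =>
    rw [hZ.last_mul hT]
    exact Submodule.smul_mem _ _ (mem_shiftSpan _ _ _)
  | cast k =>
    rw [hZ.castSucc_mul hT]
    exact Submodule.smul_mem _ _ (mem_shiftSpan _ _ _)

theorem IsSphereFamily.mul_gen_mem (hZ : IsSphereFamily q Z) (hT : IsShiftUnits T)
    (k : Fin (ℓ + 1)) {x : Hsp ℓ →L[ℂ] Hsp ℓ} (hx : x ∈ shiftSpan T) :
    x * Z k ∈ shiftSpan T := by
  refine shiftSpan_le (M := (shiftSpan T).comap (LinearMap.mulRight ℂ (Z k)))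
    (isClosed_shiftSpan.preimage (continuous_mul_const (Z k))) (fun α β m => ?_) hx
  rw [Submodule.mem_comap, LinearMap.mulRight_apply]
  induction k using Fin.lastCases with
  | last =>
    rw [hZ.mul_last hT]
    exact Submodule.smul_mem _ _ (mem_shiftSpan _ _ _)
  | cast k =>
    by_cases hβ : β k = 0
    · rw [hZ.mul_castSucc_of_eq_zero hT k α β m hβ]
      exact zero_mem _
    · have h : β = (β - Pi.single k 1) + Pi.single k 1 := by
        refine (tsub_add_cancel_of_le fun j => ?_).symm
        rcases eq_or_ne j k with rfl | hj
        · simpa using Nat.one_le_iff_ne_zero.2 hβ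
        · simp [hj]
      rw [h, hZ.mul_castSucc_add hT]
      exact Submodule.smul_mem _ _ (mem_shiftSpan _ _ _)

theorem IsSphereFamily.shiftSpan_isIdeal (hZ : IsSphereFamily q Z) (hT : IsShiftUnits T)
    {a : Hsp ℓ →L[ℂ] Hsp ℓ} (ha : a ∈ (StarAlgebra.adjoin ℂ (Set.range Z)).topologicalClosure)
    {x : Hsp ℓ →L[ℂ] Hsp ℓ} (hx : x ∈ shiftSpan T) :
    a * x ∈ shiftSpan T ∧ x * a ∈ shiftSpan T := by
  let B : Set (Hsp ℓ →L[ℂ] Hsp ℓ) :=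
    {b | ∀ y ∈ shiftSpan T, b * y ∈ shiftSpan T ∧ y * b ∈ shiftSpan T}
  have hB : IsClosed B := by
    have : B = ⋂ y ∈ shiftSpan T, {b | b * y ∈ shiftSpan T} ∩ {b | y * b ∈ shiftSpan T} := by
      ext b
      simp [B]
    rw [this]
    exact isClosed_biInter fun y _ =>
      (isClosed_shiftSpan.preimage (continuous_mul_const y)).inter
        (isClosed_shiftSpan.preimage (continuous_const_mul y))
  have hsub : (StarAlgebra.adjoin ℂ (Set.range Z) : Set (Hsp ℓ →L[ℂ] Hsp ℓ)) ⊆ B := by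
    intro b hb
    induction hb using StarAlgebra.adjoin_induction with
    | mem b hb =>
      obtain ⟨k, rfl⟩ := hb
      exact fun y hy => ⟨hZ.gen_mul_mem hT k hy, hZ.mul_gen_mem hT k hy⟩
    | algebraMap c =>
      intro y hy
      rw [← Algebra.commutes, ← Algebra.smul_def]
      exact ⟨Submodule.smul_mem _ _ hy, Submodule.smul_mem _ _ hy⟩
    | add b c _ _ hb hc =>
      intro y hy
      rw [add_mul, mul_add]
      exact ⟨add_mem (hb y hy).1 (hc y hy).1, add_mem (hb y hy).2 (hc y hy).2⟩
    | mul b c _ _ hb hc =>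
      intro y hy
      rw [mul_assoc, ← mul_assoc]
      exact ⟨(hb _ (hc y hy).1).1, (hc _ (hb y hy).2).2⟩
    | star b _ hb =>
      intro y hy
      have h := hb _ (hT.star_mem hy)
      exact ⟨by simpa using hT.star_mem h.2, by simpa using hT.star_mem h.1⟩
  exact closure_minimal hsub hB ha x hx

theorem IsSphereFamily.last_mem_shiftSpan (hq : 0 < q) (hq1 : q < 1) (hZ : IsSphereFamily q Z)
    (hT : IsShiftUnits T) : Z (Fin.last ℓ) ∈ shiftSpan T := by
  let s (N : ℕ) : Finset (Fin ℓ → ℕ) := Fintype.piFinset fun _ => Finset.range N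
  let X (N : ℕ) : Hsp ℓ →L[ℂ] Hsp ℓ := ∑ α ∈ s N, ((q ^ ∑ j, α j : ℝ) : ℂ) • T α α 1
  have hX (N : ℕ) (μ : Fin ℓ → ℕ) (n : ℤ) : X N (e ℓ (μ, n)) =
      if μ ∈ s N then ((q ^ ∑ j, μ j : ℝ) : ℂ) • e ℓ (μ, n + 1) else 0 := by
    simp only [X, sum_apply, smul_apply, hT _ _ _ _ _,
      smul_ite, smul_zero, Finset.sum_ite_eq]
  have hle (N : ℕ) : ‖X N - Z (Fin.last ℓ)‖ ≤ q ^ N := by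
    refine norm_le_of_weighted_shift (σ := fun γ => γ + (0, 1)) (add_left_injective _)
      (x := fun γ => if γ.1 ∈ s N then 0 else -((q ^ ∑ j, γ.1 j : ℝ) : ℂ)) ?_ (by positivity) ?_
    · rintro ⟨μ, n⟩
      rw [sub_apply, hX, hZ, ck_last, eps_last]
      split_ifs <;> simp
    · rintro ⟨μ, n⟩
      split_ifs with h
      · simpa using (pow_pos hq N).le
      · have : ∃ j, N ≤ μ j := by simpa [s] using h
        obtain ⟨j, hj⟩ := this
        rw [norm_neg, Complex.norm_real, Real.norm_of_nonneg (by positivity)]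
        exact pow_le_pow_of_le_one hq.le hq1.le
          (hj.trans (Finset.single_le_sum (f := μ) (fun _ _ => Nat.zero_le _) (Finset.mem_univ j)))
  have hlim : Tendsto X atTop (𝓝 (Z (Fin.last ℓ))) :=
    tendsto_iff_norm_sub_tendsto_zero.2 (squeeze_zero (fun _ => norm_nonneg _) hle
      (tendsto_pow_atTop_nhds_zero_of_lt_one hq.le hq1))
  exact isClosed_shiftSpan.mem_of_tendsto hlim (Eventually.of_forall fun N =>
    Submodule.sum_mem _ fun α _ => Submodule.smul_mem _ _ (mem_shiftSpan _ _ _))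

theorem IsSphereFamily.star_last_mul_last_apply (hZ : IsSphereFamily q Z) (γ : Gamma ℓ) :
    (star (Z (Fin.last ℓ)) * Z (Fin.last ℓ)) (e ℓ γ) =
      (((q ^ 2) ^ ∑ j, γ.1 j : ℝ) : ℂ) • e ℓ γ := by
  refine vec_ext_inner fun δ => ?_
  rw [ContinuousLinearMap.star_eq_adjoint, mul_apply_eq_comp,
    ContinuousLinearMap.adjoint_inner_right, hZ, hZ, ck_last, ck_last]
  simp only [inner_smul_left, inner_smul_right, inner_e_left, e_apply, add_left_inj,
    Complex.conj_ofReal]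
  split_ifs with h
  · rw [h]
    push_cast
    ring
  · simp

theorem IsSphereFamily.tendsto_pow (hq : 0 < q) (hq1 : q < 1) (hZ : IsSphereFamily q Z)
    (hT : IsShiftUnits T) :
    Tendsto (fun N : ℕ => (star (Z (Fin.last ℓ)) * Z (Fin.last ℓ)) ^ (N + 1)) atTop
      (𝓝 (T 0 0 0)) := by
  set D := star (Z (Fin.last ℓ)) * Z (Fin.last ℓ) with hD
  have hpow (N : ℕ) (γ : Gamma ℓ) :
      (D ^ N) (e ℓ γ) = ((((q ^ 2) ^ ∑ j, γ.1 j) ^ N : ℝ) : ℂ) • e ℓ γ := by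
    induction N with
    | zero => simp
    | succ N ih =>
      rw [pow_succ, mul_apply_eq_comp, hD, hZ.star_last_mul_last_apply, ← hD, map_smul,
        ih, smul_smul, ← Complex.ofReal_mul, pow_succ _ N, mul_comm]
  have hq2 : q ^ 2 < 1 := pow_lt_one₀ hq.le hq1 two_ne_zero
  have hle (N : ℕ) : ‖D ^ (N + 1) - T 0 0 0‖ ≤ (q ^ 2) ^ (N + 1) := by
    refine norm_le_of_weighted_shift (σ := id) Function.injective_id
      (x := fun γ => if γ.1 = 0 then 0 else ((((q ^ 2) ^ ∑ j, γ.1 j) ^ (N + 1) : ℝ) : ℂ))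
      ?_ (by positivity) ?_
    · rintro ⟨μ, n⟩
      rw [sub_apply, hpow, hT]
      split_ifs with h <;> simp [h]
    · rintro ⟨μ, n⟩
      split_ifs with h
      · simpa using (by positivity : 0 ≤ (q ^ 2) ^ (N + 1))
      · rw [Complex.norm_real, Real.norm_of_nonneg (by positivity)]
        gcongr
        refine pow_le_of_le_one (by positivity) hq2.le fun h₀ => h (funext fun j => ?_)
        exact Finset.sum_eq_zero_iff.1 h₀ j (Finset.mem_univ j)
  exact tendsto_iff_norm_sub_tendsto_zero.2 (squeeze_zero (fun _ => norm_nonneg _) hle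
    ((tendsto_add_atTop_iff_nat 1).2 (tendsto_pow_atTop_nhds_zero_of_lt_one (by positivity) hq2)))

theorem add_single_induction {P : (Fin ℓ → ℕ) → Prop} (h0 : P 0)
    (hadd : ∀ α k, P α → P (α + Pi.single k 1)) (α : Fin ℓ → ℕ) : P α := by
  induction hn : ∑ j, α j generalizing α with
  | zero =>
    have : α = 0 := funext fun j => Finset.sum_eq_zero_iff.1 hn j (Finset.mem_univ j)
    exact this ▸ h0
  | succ n ih =>
    obtain ⟨k, -, hk⟩ := Finset.exists_ne_zero_of_sum_ne_zero (hn.trans_ne n.succ_ne_zero)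
    have h : (α - Pi.single k 1) + Pi.single k 1 = α := by
      refine tsub_add_cancel_of_le fun j => ?_
      rcases eq_or_ne j k with rfl | hj
      · simpa using Nat.one_le_iff_ne_zero.2 hk
      · simp [hj]
    rw [← h]
    refine hadd _ _ (ih _ ?_)
    have hs := congrArg (fun f : Fin ℓ → ℕ => ∑ j, f j) h
    simp only [Pi.add_apply, Finset.sum_add_distrib, Finset.sum_pi_single', Finset.mem_univ,
      if_true] at hs
    omega

/-- A closed subspace which is an ideal for a star-algebra `A ∋ Z₁, …, Z_{ℓ+1}` and contains
`Z_{ℓ+1}` contains all `T_{α,β,m}`. -/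
theorem IsSphereFamily.mem_of_isIdeal (hq : 0 < q) (hq1 : q < 1) (hZ : IsSphereFamily q Z)
    (hT : IsShiftUnits T) {A : StarSubalgebra ℂ (Hsp ℓ →L[ℂ] Hsp ℓ)} (hA : ∀ k, Z k ∈ A)
    {M : Submodule ℂ (Hsp ℓ →L[ℂ] Hsp ℓ)} (hM : IsClosed (M : Set (Hsp ℓ →L[ℂ] Hsp ℓ)))
    (hlast : Z (Fin.last ℓ) ∈ M) (hideal : ∀ a ∈ A, ∀ x ∈ M, a * x ∈ M ∧ x * a ∈ M)
    (α β : Fin ℓ → ℕ) (m : ℤ) : T α β m ∈ M := by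
  have cancel {c : ℝ} (hc : c ≠ 0) {x : Hsp ℓ →L[ℂ] Hsp ℓ} (h : (c : ℂ) • x ∈ M) : x ∈ M :=
    (Submodule.smul_mem_iff _ (Complex.ofReal_ne_zero.2 hc)).1 h
  have hstar (k) : star (Z k) ∈ A := star_mem (hA k)
  have h0 : T 0 0 0 ∈ M := by
    refine hM.mem_of_tendsto (hZ.tendsto_pow hq hq1 hT) (Eventually.of_forall fun N => ?_)
    rw [SetLike.mem_coe, pow_succ, ← mul_assoc]
    exact (hideal _ (mul_mem (pow_mem (mul_mem (hstar _) (hA _)) _) (hstar _)) _ hlast).1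
  have hm : T 0 0 m ∈ M := by
    induction m using Int.induction_on with
    | zero => exact h0
    | succ n ih =>
      refine cancel (pow_pos hq (∑ j, (0 : Fin ℓ → ℕ) j)).ne' ?_
      rw [← hZ.last_mul hT]
      exact (hideal _ (hA _) _ ih).1
    | pred n ih =>
      have h : T 0 0 (-n) * star (Z (Fin.last ℓ)) =
          ((q ^ ∑ j, (0 : Fin ℓ → ℕ) j : ℝ) : ℂ) • T 0 0 (-n - 1) := by
        have := congrArg star (hZ.last_mul hT 0 0 (n : ℤ))
        rw [star_mul, star_smul, hT.star_eq, hT.star_eq] at this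
        rw [this, neg_add', Complex.star_def, Complex.conj_ofReal]
      refine cancel (pow_pos hq (∑ j, (0 : Fin ℓ → ℕ) j)).ne' ?_
      rw [← h]
      exact (hideal _ (hstar _) _ ih).2
  have hα : T α 0 m ∈ M := by
    refine add_single_induction (P := fun α => T α 0 m ∈ M) hm (fun α k ih => ?_) α
    refine cancel (ck_ne_zero hq hq1 k.castSucc (α, 0)) ?_
    rw [← hZ.castSucc_mul hT]
    exact (hideal _ (hA _) _ ih).1
  refine add_single_induction (P := fun β => T α β m ∈ M) hα (fun β k ih => ?_) β
  refine cancel (ck_ne_zero hq hq1 k.castSucc (β, 0)) ?_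
  have h : T α β m * star (Z k.castSucc) =
      ((ck ℓ q k.castSucc (β, 0) : ℝ) : ℂ) • T α (β + Pi.single k 1) m := by
    have := congrArg star (hZ.castSucc_mul hT k β α (-m))
    rw [star_mul, star_smul, hT.star_eq, hT.star_eq] at this
    rw [neg_neg] at this
    rw [this, Complex.star_def, Complex.conj_ofReal]
  rw [← h]
  exact (hideal _ (hstar _) _ ih).2

end Helpers

/-- the smallest closed two-sided ideal `J` of
`A = C*(Z₁,…,Z_{ℓ+1}) ≅ C(S_q^{2ℓ+1})` containing `Z_{ℓ+1}` equals the closed linear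
span of the operators `T_{α,β,m} : e_{(μ,n)} ↦ [μ = β]·e_{(α,n+m)}`, i.e.
`J ≅ K(ℓ²(ℕ^ℓ)) ⊗ C(S¹)`.  Here `J` is expressed as the intersection of all closed
subsets of `A` that contain `Z_{ℓ+1}` and are two-sided `A`-ideals (ℂ-submodules closed
under multiplication by `A` on both sides). -/
theorem stmt16 (ℓ : ℕ) (hℓ : 1 ≤ ℓ) (q : ℝ) (hq : 0 < q) (hq1 : q < 1)
    (Z : Fin (ℓ+1) → Hsp ℓ →L[ℂ] Hsp ℓ)
    (hZ : ∀ (k : Fin (ℓ+1)) (γ : Gamma ℓ),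
      Z k (e ℓ γ) = ((ck ℓ q k γ : ℝ) : ℂ) • e ℓ (γ + eps ℓ k))
    (T : (Fin ℓ → ℕ) → (Fin ℓ → ℕ) → ℤ → Hsp ℓ →L[ℂ] Hsp ℓ)
    (hT : ∀ (α β : Fin ℓ → ℕ) (m : ℤ) (μ : Fin ℓ → ℕ) (n : ℤ),
      T α β m (e ℓ (μ, n)) = if μ = β then e ℓ (α, n + m) else 0) :
    ((Submodule.span ℂ
        (Set.range fun p : (Fin ℓ → ℕ) × (Fin ℓ → ℕ) × ℤ =>
          T p.1 p.2.1 p.2.2)).topologicalClosure : Set (Hsp ℓ →L[ℂ] Hsp ℓ)) =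
      ⋂₀ {I : Set (Hsp ℓ →L[ℂ] Hsp ℓ) |
        IsClosed I ∧
        I ⊆ ((StarAlgebra.adjoin ℂ (Set.range Z)).topologicalClosure :
              Set (Hsp ℓ →L[ℂ] Hsp ℓ)) ∧
        Z (Fin.last ℓ) ∈ I ∧
        (0 : Hsp ℓ →L[ℂ] Hsp ℓ) ∈ I ∧
        (∀ x ∈ I, ∀ y ∈ I, x + y ∈ I) ∧
        (∀ c : ℂ, ∀ x ∈ I, c • x ∈ I) ∧
        (∀ a ∈ (StarAlgebra.adjoin ℂ (Set.range Z)).topologicalClosure,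
          ∀ x ∈ I, a * x ∈ I ∧ x * a ∈ I)} := by
  have hZ' : IsSphereFamily q Z := hZ
  have hT' : IsShiftUnits T := hT
  let A := (StarAlgebra.adjoin ℂ (Set.range Z)).topologicalClosure
  have hA (k) : Z k ∈ A :=
    StarSubalgebra.le_topologicalClosure _ (StarAlgebra.subset_adjoin ℂ _ ⟨k, rfl⟩)
  have hAclosed : IsClosed (A : Set (Hsp ℓ →L[ℂ] Hsp ℓ)) :=
    StarSubalgebra.isClosed_topologicalClosure _
  change (shiftSpan T : Set (Hsp ℓ →L[ℂ] Hsp ℓ)) = _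
  refine Set.Subset.antisymm (Set.subset_sInter ?_) (Set.sInter_subset_of_mem ?_)
  · rintro I ⟨hI, -, hlast, hzero, hadd, hsmul, hideal⟩
    let M : Submodule ℂ (Hsp ℓ →L[ℂ] Hsp ℓ) :=
      { carrier := I
        add_mem' := fun {a b} ha hb => hadd a ha b hb
        zero_mem' := hzero
        smul_mem' := fun c x hx => hsmul c x hx }
    exact shiftSpan_le (M := M) hI (hZ'.mem_of_isIdeal hq hq1 hT' hA hI hlast hideal)
  · have hle : shiftSpan T ≤ Subalgebra.toSubmodule A.toSubalgebra :=
      shiftSpan_le hAclosed (hZ'.mem_of_isIdeal hq hq1 hT' hA hAclosed (hA _)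
        fun _ ha _ hx => ⟨A.mul_mem ha hx, A.mul_mem hx ha⟩)
    exact ⟨isClosed_shiftSpan, hle, hZ'.last_mem_shiftSpan hq hq1 hT', zero_mem _,
      fun _ hx _ hy => add_mem hx hy, fun c _ hx => Submodule.smul_mem _ c hx,
      fun _ ha _ hx => hZ'.shiftSpan_isIdeal hT' ha hx⟩
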